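/- With f₀, h, Ω as in the context: let k ≥ 2 be an integer, let w satisfy w_k ≤ w ≤ w_{k+1}, let R satisfy 1/(2√(k+2)) ≤ R ≤ 1/(2√(k−1)), and let y* ∈ T³. Then mes₃{ y ∈ T³ : dist(y, y*) ≤ R and (w,y) ∈ Ω } ≤ 24π·R³·√h, where dist is the quotient (flat) metric on T³. -/

import Mathlib

open Real MeasureTheory

noncomputable section

/-- `w_k = (27/8)·k^{3/2}`. -/
def wseq (k : ℕ) : ℝ := (27 / 8) * (k : ℝ) ^ ((3 : ℝ) / 2)

/-- The properties of the fixed cutoff function `ζ`: smooth, `ζ = 0` on `(-∞,0]`,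
`ζ = 1` on `[1,∞)`, `0 ≤ ζ ≤ 1`, `ζ' > 0` on `(0,1)`, and `ζ(t) + ζ(1-t) = 1`. -/
def IsCutoff (ζ : ℝ → ℝ) : Prop :=
  ContDiff ℝ (⊤ : ℕ∞) ζ ∧ (∀ t : ℝ, t ≤ 0 → ζ t = 0) ∧ (∀ t : ℝ, 1 ≤ t → ζ t = 1) ∧
    (∀ t : ℝ, ζ t ∈ Set.Icc (0 : ℝ) 1) ∧ (∀ t ∈ Set.Ioo (0 : ℝ) 1, 0 < deriv ζ t) ∧
    (∀ t : ℝ, ζ t + ζ (1 - t) = 1)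

/-- The properties of the fixed sequence `(a_k)` in `ℤ³`:
`|a_k|² = 4k+1` and `|a_k · a_{k+1}| ≤ |a_k||a_{k+1}|/√3` for all `k ≥ 1`. -/
def IsGoodSeq (a : ℕ → Fin 3 → ℤ) : Prop :=
  ∀ k : ℕ, 1 ≤ k →
    ((∑ i : Fin 3, (a k i) ^ 2 = 4 * (k : ℤ) + 1) ∧
      |∑ i : Fin 3, ((a k i : ℝ) * (a (k + 1) i : ℝ))| ≤
        Real.sqrt (∑ i : Fin 3, (a k i : ℝ) ^ 2) *
          Real.sqrt (∑ i : Fin 3, (a (k + 1) i : ℝ) ^ 2) / Real.sqrt 3)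

/-- The function `f₀(w,y) = Σ_{k≥2} ζ((w-w_{k-1})/(w_k-w_{k-1}))·ζ((w_{k+1}-w)/(w_{k+1}-w_k))·cos(a_k·y)`
(a locally finite sum), `2π`-periodic in each coordinate of `y`. -/
def f0 (ζ : ℝ → ℝ) (a : ℕ → Fin 3 → ℤ) (w : ℝ) (y : Fin 3 → ℝ) : ℝ :=
  ∑' k : ℕ, if 2 ≤ k then
      ζ ((w - wseq (k - 1)) / (wseq k - wseq (k - 1))) *
        ζ ((wseq (k + 1) - w) / (wseq (k + 1) - wseq k)) *
        Real.cos (∑ i : Fin 3, (a k i : ℝ) * y i)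
    else 0

/-- `h = (2e)^{-10}`. -/
def hSmall : ℝ := 1 / (2 * Real.exp 1) ^ 10

/-- `Ω = {(w,y) : w ≥ w₂, |f₀(w,y)| < 2h}`, viewed as the (2π-periodic in `y`)
subset of `ℝ × ℝ³` corresponding to a subset of `ℝ × T³`. -/
def OmegaSet (ζ : ℝ → ℝ) (a : ℕ → Fin 3 → ℤ) : Set (ℝ × (Fin 3 → ℝ)) :=
  {p | wseq 2 ≤ p.1 ∧ |f0 ζ a p.1 p.2| < 2 * hSmall}

end

noncomputable section
open Real MeasureTheory

/-- The flat (quotient) distance on the torus `T³ = ℝ³/(2πℤ)³`, computed on representatives. -/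
def torusDist (y z : Fin 3 → ℝ) : ℝ :=
  ⨅ m : Fin 3 → ℤ, Real.sqrt (∑ i : Fin 3, (y i - z i - 2 * π * (m i)) ^ 2)

lemma abs_sub_le_of_abs_cos_add_lt {c δ x y : ℝ} (hδ : δ ≤ 1 / 10000)
    (hx : x ∈ Set.Icc 0 π) (hy : y ∈ Set.Icc 0 π)
    (hxc : |cos x + c| < δ) (hyc : |cos y + c| < δ) : |x - y| ≤ 2.02 * √δ := by
  wlog hxy : y ≤ x generalizing x y
  · rw [abs_sub_comm]
    exact this hy hx hyc hxc (le_of_not_ge hxy)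
  obtain ⟨hx0, hxπ⟩ := hx
  obtain ⟨hy0, hyπ⟩ := hy
  rw [abs_of_nonneg (sub_nonneg.2 hxy)]
  rw [abs_lt] at hxc hyc
  have hδ0 : 0 < δ := by linarith
  set d := (x - y) / 2 with hd
  have hd0 : 0 ≤ d := by rw [hd]; linarith
  have hdπ : d ≤ π / 2 := by rw [hd]; linarith
  have hprod : sin ((x + y) / 2) * sin d < δ := by
    have := cos_sub_cos x y
    rw [← hd] at this
    linarith
  have hsd0 : 0 ≤ sin d := sin_nonneg_of_nonneg_of_le_pi hd0 (by linarith)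
  have hmid : sin d ≤ sin ((x + y) / 2) := by
    rcases le_total ((x + y) / 2) (π / 2) with h | h
    · exact sin_le_sin_of_le_of_le_pi_div_two (by linarith) h (by rw [hd]; linarith)
    · rw [← sin_pi_sub ((x + y) / 2)]
      exact sin_le_sin_of_le_of_le_pi_div_two (by linarith) (by linarith) (by rw [hd]; linarith)
  have hsq : sin d < √δ := by
    apply lt_sqrt_of_sq_lt
    nlinarith
  have hs1 : √δ ≤ 1 / 100 := by
    rw [sqrt_le_left (by norm_num)]
    linarith
  have hjordan := mul_le_sin hd0 hdπ
  have hdsmall : d ≤ 1 / 50 := by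
    have h1 : 2 / π * d ≤ 1 / 100 := by linarith
    rw [div_mul_eq_mul_div, div_le_iff₀ pi_pos] at h1
    linarith [pi_lt_four]
  rcases hd0.eq_or_lt with h | h
  · have : x - y = 0 := by linarith
    rw [this]; positivity
  · have hcube := sin_gt_sub_cube h
    have : d ^ 3 ≤ d / 2500 := by nlinarith [mul_nonneg hd0 (sub_nonneg.2 hdsmall)]
    linarith

lemma volume_abs_cos_add_lt_le (c s : ℝ) {δ : ℝ} (hδ : δ ≤ 1 / 10000) :
    volume ({θ | |cos θ + c| < δ} ∩ Set.Ioc s (s + 2 * π)) ≤ ENNReal.ofReal (4.04 * √δ) := by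
  set A : Set ℝ := {θ | |cos θ + c| < δ} with hA
  have hAm : MeasurableSet A := (isOpen_lt (by fun_prop) continuous_const).measurableSet
  have hdiam : ∀ B ⊆ A, (∀ x ∈ B, ∀ y ∈ B, |x - y| ≤ 2.02 * √δ) →
      volume B ≤ ENNReal.ofReal (2.02 * √δ) := fun B _ hB ↦
    (volume_le_diam B).trans <| Metric.ediam_le fun x hx y hy ↦ by
      rw [edist_dist, Real.dist_eq]
      exact ENNReal.ofReal_le_ofReal (hB x hx y hy)
  have hpos : volume (A ∩ Set.Icc 0 π) ≤ ENNReal.ofReal (2.02 * √δ) :=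
    hdiam _ Set.inter_subset_left fun x hx y hy ↦
      abs_sub_le_of_abs_cos_add_lt hδ hx.2 hy.2 hx.1 hy.1
  have hneg : volume (A ∩ Set.Icc (-π) 0) ≤ ENNReal.ofReal (2.02 * √δ) :=
    hdiam _ Set.inter_subset_left fun x hx y hy ↦ by
      have := abs_sub_le_of_abs_cos_add_lt (c := c) (x := -y) (y := -x) hδ
        ⟨by linarith [hy.2.2], by linarith [hy.2.1]⟩ ⟨by linarith [hx.2.2], by linarith [hx.2.1]⟩
        (by rw [cos_neg]; exact hy.1) (by rw [cos_neg]; exact hx.1)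
      rwa [neg_sub_neg] at this
  have hshift : volume (A ∩ Set.Ioc s (s + 2 * π)) = volume (A ∩ Set.Ioc (-π) (-π + 2 * π)) := by
    refine (isAddFundamentalDomain_Ioc two_pi_pos s).measure_set_eq
      (isAddFundamentalDomain_Ioc two_pi_pos (-π)) hAm ?_
    rintro ⟨g, n, rfl⟩
    ext θ
    change |cos (n • (2 * π) + θ) + c| < δ ↔ |cos θ + c| < δ
    rw [zsmul_eq_mul, add_comm _ θ, cos_add_int_mul_two_pi]
  rw [hshift]
  calc volume (A ∩ Set.Ioc (-π) (-π + 2 * π))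
      ≤ volume (A ∩ Set.Icc (-π) 0 ∪ A ∩ Set.Icc 0 π) := by
        refine measure_mono fun θ ⟨hθ, h1, h2⟩ ↦ ?_
        rcases le_total θ 0 with h | h
        · exact Or.inl ⟨hθ, h1.le, h⟩
        · exact Or.inr ⟨hθ, h, by linarith⟩
    _ ≤ ENNReal.ofReal (2.02 * √δ) + ENNReal.ofReal (2.02 * √δ) :=
        (measure_union_le _ _).trans (add_le_add hneg hpos)
    _ = ENNReal.ofReal (4.04 * √δ) := by
        rw [← ENNReal.ofReal_add (by positivity) (by positivity)]
        congr 1; ring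

lemma volume_le_of_forall_volume_line_le {A : Set (EuclideanSpace ℝ (Fin 3))}
    (hA : MeasurableSet A) {r : ℝ} (hr : 0 ≤ r) (hball : ∀ x ∈ A, ‖x‖ ≤ r)
    {v : EuclideanSpace ℝ (Fin 3)} (hv : ‖v‖ = 1) {C : ENNReal}
    (hC : ∀ x, volume {t : ℝ | x + t • v ∈ A} ≤ C) :
    volume A ≤ C * ENNReal.ofReal (4 * r ^ 2) := by
  obtain ⟨e, he⟩ := Orthonormal.exists_orthonormalBasis_extension_of_card_eq (𝕜 := ℝ)
    (E := EuclideanSpace ℝ (Fin 3)) (ι := Fin 3) (by simp) (v := fun _ ↦ v) (s := {0}) (by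
      refine ⟨fun _ ↦ hv, fun i j hij ↦ (hij (Subsingleton.elim _ _)).elim⟩)
  have he0 : e 0 = v := he 0 rfl
  have hΦ := (e.measurePreserving_repr_symm.comp (PiLp.volume_preserving_toLp (Fin 3))).comp
    (volume_preserving_piFinSuccAbove (fun _ : Fin 3 ↦ ℝ) 0).symm
  set Φ := (⇑e.repr.symm ∘ (WithLp.toLp 2 : (Fin 3 → ℝ) → _)) ∘
    ⇑(MeasurableEquiv.piFinSuccAbove (fun _ : Fin 3 ↦ ℝ) 0).symm with hΦdef
  have hrepr : ∀ p, e.repr (Φ p) = WithLp.toLp 2 (Fin.cons p.1 p.2 : Fin 3 → ℝ) := by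
    intro p
    simp [hΦdef, MeasurableEquiv.piFinSuccAbove]
    rfl
  have hline : ∀ t z, Φ (t, z) = Φ (0, z) + t • v := by
    intro t z
    apply e.repr.injective
    rw [map_add, map_smul, ← he0, e.repr_self, hrepr, hrepr]
    ext i
    refine Fin.cases ?_ (fun i ↦ ?_) i <;> simp
  rw [← hΦ.measure_preimage hA.nullMeasurableSet, Measure.volume_eq_prod,
    Measure.prod_apply_symm (hΦ.measurable hA)]
  set Q : Set (Fin 2 → ℝ) := Set.pi Set.univ fun _ ↦ Set.Icc (-r) r
  calc ∫⁻ z, volume ((fun t ↦ (t, z)) ⁻¹' (Φ ⁻¹' A))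
      ≤ ∫⁻ z, Q.indicator (fun _ ↦ C) z := by
        refine lintegral_mono fun z ↦ ?_
        by_cases hz : z ∈ Q
        · rw [Set.indicator_of_mem hz]
          refine le_trans (le_of_eq ?_) (hC (Φ (0, z)))
          congr 1
          ext t
          simp only [Set.mem_preimage, Set.mem_ofPred_eq, hline t z]
        · rw [Set.indicator_of_notMem hz, nonpos_iff_eq_zero]
          convert measure_empty (μ := (volume : Measure ℝ))
          rw [Set.eq_empty_iff_forall_notMem]
          intro t ht
          refine hz fun i _ ↦ ?_
          have h1 := hball _ ht
          rw [← e.repr.norm_map, hrepr] at h1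
          have h2 := (PiLp.norm_apply_le (WithLp.toLp 2 (Fin.cons t z : Fin 3 → ℝ)) i.succ).trans h1
          simpa [abs_le] using h2
    _ = C * volume Q := lintegral_indicator_const (MeasurableSet.univ_pi fun _ ↦ measurableSet_Icc) C
    _ = C * ENNReal.ofReal (4 * r ^ 2) := by
        congr 1
        rw [volume_pi_pi]
        simp only [Real.volume_Icc, Fin.prod_univ_two]
        rw [← ENNReal.ofReal_mul (by linarith)]
        congr 1; ring

open scoped InnerProductSpace in
lemma volume_closedBall_inter_abs_add_cos_lt_le {p q : EuclideanSpace ℝ (Fin 3)}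
    (hp : p ≠ 0) (hq : q ≠ 0) (hpq : |⟪p, q⟫_ℝ| ≤ ‖p‖ * ‖q‖ / √3) {α β u v r η : ℝ}
    (hα : 1 / 2 ≤ α) (hr : 0 ≤ r) (hpr : ‖p‖ * r < π) (hη : η ≤ 1 / 20000) :
    volume {x : EuclideanSpace ℝ (Fin 3) |
        ‖x‖ ≤ r ∧ |α * cos (⟪p, x⟫_ℝ + u) + β * cos (⟪q, x⟫_ℝ + v)| < η} ≤
      ENNReal.ofReal (20 * r ^ 2 * √(2 * η) / ‖p‖) := by
  have hp0 : 0 < ‖p‖ := norm_pos_iff.2 hp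
  have hq0 : 0 < ‖q‖ := norm_pos_iff.2 hq
  set m := p - (⟪p, q⟫_ℝ / ‖q‖ ^ 2) • q with hm
  have hqm : ⟪q, m⟫_ℝ = 0 := by
    rw [hm, inner_sub_right, inner_smul_right, real_inner_self_eq_norm_sq, real_inner_comm]
    field_simp
    ring
  have hpm : ⟪p, m⟫_ℝ = ‖m‖ ^ 2 := by
    rw [← real_inner_self_eq_norm_sq]
    nth_rewrite 2 [hm]
    rw [inner_sub_left, inner_smul_left, hqm, mul_zero, sub_zero]
  have hmsq : ‖m‖ ^ 2 = ‖p‖ ^ 2 - ⟪p, q⟫_ℝ ^ 2 / ‖q‖ ^ 2 := by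
    rw [← hpm, hm, inner_sub_right, inner_smul_right, real_inner_self_eq_norm_sq]
    ring
  have hmle : ‖m‖ ≤ ‖p‖ := by
    refine le_of_sq_le_sq ?_ hp0.le
    rw [hmsq]
    have : 0 ≤ ⟪p, q⟫_ℝ ^ 2 / ‖q‖ ^ 2 := by positivity
    linarith
  have hmge : 0.81 * ‖p‖ ≤ ‖m‖ := by
    refine le_of_sq_le_sq ?_ (norm_nonneg m)
    have h1 : ⟪p, q⟫_ℝ ^ 2 ≤ (‖p‖ * ‖q‖ / √3) ^ 2 := sq_le_sq' (abs_le.1 hpq).1 (abs_le.1 hpq).2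
    rw [div_pow, sq_sqrt (by norm_num)] at h1
    have h2 : ⟪p, q⟫_ℝ ^ 2 / ‖q‖ ^ 2 ≤ ‖p‖ ^ 2 / 3 := by
      rw [div_le_iff₀ (by positivity)]
      nlinarith
    rw [hmsq, mul_pow]
    nlinarith
  have hm0 : 0 < ‖m‖ := by linarith
  set e := ‖m‖⁻¹ • m with he
  have he1 : ‖e‖ = 1 := by
    rw [he, norm_smul, norm_inv, norm_norm, inv_mul_cancel₀ hm0.ne']
  have hpe : ⟪p, e⟫_ℝ = ‖m‖ := by
    rw [he, inner_smul_right, hpm]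
    field_simp
  have hqe : ⟪q, e⟫_ℝ = 0 := by rw [he, inner_smul_right, hqm, mul_zero]
  have hη' : 2 * η ≤ 1 / 10000 := by linarith
  refine (volume_le_of_forall_volume_line_le (r := r) (v := e)
    (C := ENNReal.ofReal |‖m‖⁻¹| * ENNReal.ofReal (4.04 * √(2 * η))) ?_ hr (fun x hx ↦ hx.1) he1
    fun x ↦ ?_).trans ?_
  · have hcont : Continuous fun x ↦ |α * cos (⟪p, x⟫_ℝ + u) + β * cos (⟪q, x⟫_ℝ + v)| := by
      fun_prop
    exact (isClosed_le continuous_norm continuous_const).measurableSet.inter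
      (isOpen_lt hcont continuous_const).measurableSet
  · set τ := ⟪p, x⟫_ℝ + u with hτ
    set κ := ⟪e, x⟫_ℝ with hκ
    set c := β / α * cos (⟪q, x⟫_ℝ + v)
    set B : Set ℝ := {θ | |cos θ + c| < 2 * η} ∩
      Set.Ioc (τ - ‖m‖ * κ - π) (τ - ‖m‖ * κ - π + 2 * π)
    calc _ ≤ volume ((‖m‖ * ·) ⁻¹' ((· + τ) ⁻¹' B)) := by
          refine measure_mono fun t ⟨ht1, ht2⟩ ↦ ?_
          change |cos (‖m‖ * t + τ) + c| < 2 * η ∧ ‖m‖ * t + τ ∈ Set.Ioc _ _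
          rw [inner_add_right, inner_smul_right, hpe, inner_add_right, inner_smul_right, hqe,
            mul_zero, add_zero, show ⟪p, x⟫_ℝ + t * ‖m‖ + u = ‖m‖ * t + τ by rw [hτ]; ring] at ht2
          constructor
          · have h1 : α * (cos (‖m‖ * t + τ) + c) =
                α * cos (‖m‖ * t + τ) + β * cos (⟪q, x⟫_ℝ + v) := by
              simp only [c]
              field_simp
            rw [← h1, abs_mul, abs_of_pos (by linarith)] at ht2
            nlinarith [abs_nonneg (cos (‖m‖ * t + τ) + c)]
          · have h2 := (abs_real_inner_le_norm e (x + t • e)).trans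
              ((mul_le_mul_of_nonneg_left ht1 (norm_nonneg e)).trans_eq (by rw [he1, one_mul]))
            rw [inner_add_right, inner_smul_right, real_inner_self_eq_norm_sq, he1, one_pow,
              mul_one, ← hκ, abs_le] at h2
            have h3 : ‖m‖ * r < π := (mul_le_mul_of_nonneg_right hmle hr).trans_lt hpr
            have h4 := mul_le_mul_of_nonneg_left h2.1 hm0.le
            have h5 := mul_le_mul_of_nonneg_left h2.2 hm0.le
            constructor <;> linarith
      _ = ENNReal.ofReal |‖m‖⁻¹| * volume B := by
          rw [Real.volume_preimage_mul_left hm0.ne', measure_preimage_add_right]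
      _ ≤ _ := by
          gcongr
          exact volume_abs_cos_add_lt_le _ _ hη'
  · rw [← ENNReal.ofReal_mul (abs_nonneg _), ← ENNReal.ofReal_mul (by positivity)]
    refine ENNReal.ofReal_le_ofReal ?_
    rw [abs_of_pos (inv_pos.2 hm0), le_div_iff₀ hp0]
    have : ‖m‖⁻¹ * ‖p‖ ≤ 1 / 0.81 := by
      rw [inv_mul_le_iff₀ hm0]
      linarith
    calc _ = (‖m‖⁻¹ * ‖p‖) * (16.16 * r ^ 2 * √(2 * η)) := by ring
      _ ≤ 1 / 0.81 * (16.16 * r ^ 2 * √(2 * η)) := by gcongr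
      _ ≤ _ := by
          have : 0 ≤ r ^ 2 * √(2 * η) := by positivity
          linarith

lemma volume_le_of_translate_mem {S T : Set (Fin 3 → ℝ)} (hT : MeasurableSet T)
    (hS : ∀ y ∈ S, (∀ i, y i ∈ Set.Ico (-π) π) ∧
      ∃ m : Fin 3 → ℤ, (fun i ↦ y i - 2 * π * m i) ∈ T) :
    volume S ≤ volume T := by
  set D : Set (Fin 3 → ℝ) := Set.pi Set.univ fun _ ↦ Set.Ico (-π) π
  have hD : MeasurableSet D := MeasurableSet.univ_pi fun _ ↦ measurableSet_Ico
  let c : (Fin 3 → ℤ) → Fin 3 → ℝ := fun m i ↦ 2 * π * m i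
  have hmeas : ∀ m, MeasurableSet ((· + c m) ⁻¹' D ∩ T) := fun m ↦
    (hD.preimage (measurable_add_const _)).inter hT
  calc volume S ≤ volume (⋃ m, (· + -c m) ⁻¹' ((· + c m) ⁻¹' D ∩ T)) := by
        refine measure_mono fun y hy ↦ ?_
        obtain ⟨hy1, m, hm⟩ := hS y hy
        refine Set.mem_iUnion.2 ⟨m, ?_, ?_⟩
        · change y + -c m + c m ∈ D
          rw [neg_add_cancel_right]
          exact fun i _ ↦ hy1 i
        · exact hm
    _ ≤ ∑' m, volume ((· + -c m) ⁻¹' ((· + c m) ⁻¹' D ∩ T)) := measure_iUnion_le _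
    _ = ∑' m, volume ((· + c m) ⁻¹' D ∩ T) := by simp_rw [measure_preimage_add_right]
    _ ≤ volume (⋃ m, (· + c m) ⁻¹' D ∩ T) := by
        refine tsum_meas_le_meas_iUnion_of_disjoint _ hmeas fun m n hmn ↦ ?_
        rw [Function.onFun, Set.disjoint_left]
        rintro y ⟨hym, -⟩ ⟨hyn, -⟩
        refine hmn (funext fun i ↦ ?_)
        have h1 : -π ≤ y i + 2 * π * m i ∧ y i + 2 * π * m i < π := hym i trivial
        have h2 : -π ≤ y i + 2 * π * n i ∧ y i + 2 * π * n i < π := hyn i trivial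
        have h3 : 2 * π * ((m i : ℝ) - n i) < 2 * π * 1 := by linarith
        have h4 : 2 * π * ((n i : ℝ) - m i) < 2 * π * 1 := by linarith
        have h5 := lt_of_mul_lt_mul_left h3 two_pi_pos.le
        have h6 := lt_of_mul_lt_mul_left h4 two_pi_pos.le
        have h7 : m i - n i < 1 := by exact_mod_cast h5
        have h8 : n i - m i < 1 := by exact_mod_cast h6
        omega
    _ ≤ volume T := measure_mono (Set.iUnion_subset fun m ↦ Set.inter_subset_right)

lemma wseq_strictMono : StrictMono wseq := fun i j hij ↦ by
  unfold wseq
  have : (i : ℝ) < j := by exact_mod_cast hij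
  gcongr

lemma exists_f0_eq {ζ : ℝ → ℝ} (hζ : IsCutoff ζ) (a : ℕ → Fin 3 → ℤ) {k : ℕ} (hk : 2 ≤ k) {w : ℝ}
    (hw1 : wseq k ≤ w) (hw2 : w ≤ wseq (k + 1)) :
    ∃ z : ℝ, ∀ y, f0 ζ a w y =
      (1 - z) * cos (∑ i, (a k i : ℝ) * y i) + z * cos (∑ i, (a (k + 1) i : ℝ) * y i) := by
  obtain ⟨-, hζ0, hζ1, -, -, hζadd⟩ := hζ
  have hpos : ∀ {i j}, i < j → 0 < wseq j - wseq i := fun h ↦ sub_pos.2 (wseq_strictMono h)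
  have hone : ∀ i j, i < j → wseq j ≤ w → ζ ((w - wseq i) / (wseq j - wseq i)) = 1 :=
    fun i j hij hj ↦ hζ1 _ <| (one_le_div (hpos hij)).2 (by linarith)
  refine ⟨ζ ((w - wseq k) / (wseq (k + 1) - wseq k)), fun y ↦ ?_⟩
  rw [f0, tsum_eq_sum (s := {k, k + 1}), Finset.sum_pair (by omega), if_pos hk,
    if_pos (by omega), hone (k - 1) k (by omega) hw1, Nat.add_sub_cancel,
    hζ1 ((wseq (k + 1 + 1) - w) / (wseq (k + 1 + 1) - wseq (k + 1)))
      ((one_le_div (hpos (by omega))).2 (by linarith))]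
  · have h1 := hζadd ((w - wseq k) / (wseq (k + 1) - wseq k))
    rw [show 1 - (w - wseq k) / (wseq (k + 1) - wseq k) =
      (wseq (k + 1) - w) / (wseq (k + 1) - wseq k) by
        have := (hpos (Nat.lt_succ_self k)).ne'
        field_simp
        ring] at h1
    rw [eq_sub_of_add_eq' h1]
    ring
  · intro j hj
    simp only [Finset.mem_insert, Finset.mem_singleton, not_or] at hj
    split_ifs with h2
    · rcases Nat.lt_or_gt_of_ne hj.1 with h | h
      · have h3 : wseq (j + 1) ≤ wseq k := wseq_strictMono.monotone (by omega)
        rw [hζ0 ((wseq (j + 1) - w) / _)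
          (div_nonpos_of_nonpos_of_nonneg (by linarith) (hpos (by omega)).le)]
        ring
      · have h3 : wseq (k + 1) ≤ wseq (j - 1) := wseq_strictMono.monotone (by omega)
        rw [hζ0 ((w - wseq (j - 1)) / _)
          (div_nonpos_of_nonpos_of_nonneg (by linarith) (hpos (by omega)).le)]
        ring
    · rfl

lemma hSmall_le : hSmall ≤ 1 / 40000 := by
  unfold hSmall
  have h : (4 : ℝ) ^ 10 ≤ (2 * exp 1) ^ 10 := by
    gcongr
    linarith [add_one_le_exp (1 : ℝ)]
  exact one_div_le_one_div_of_le (by norm_num) (by linarith)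

/-- The integer vector `b`, as a vector of the Euclidean space. -/
abbrev intVec (b : Fin 3 → ℤ) : EuclideanSpace ℝ (Fin 3) := WithLp.toLp 2 fun i ↦ (b i : ℝ)

open scoped InnerProductSpace in
lemma inner_intVec (b : Fin 3 → ℤ) (x : EuclideanSpace ℝ (Fin 3)) :
    ⟪intVec b, x⟫_ℝ = ∑ i, (b i : ℝ) * x i := by
  simp [PiLp.inner_apply, mul_comm]

lemma norm_intVec (b : Fin 3 → ℤ) : ‖intVec b‖ = √(∑ i, (b i : ℝ) ^ 2) := by
  simp [EuclideanSpace.norm_eq]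

lemma cos_sum_mul_sub_two_pi (b m : Fin 3 → ℤ) (y : Fin 3 → ℝ) :
    cos (∑ i, (b i : ℝ) * (y i - 2 * π * m i)) = cos (∑ i, (b i : ℝ) * y i) := by
  have : ∑ i, (b i : ℝ) * (y i - 2 * π * m i) =
      ∑ i, (b i : ℝ) * y i - ((∑ i, b i * m i : ℤ) : ℝ) * (2 * π) := by
    push_cast
    rw [Finset.sum_mul, ← Finset.sum_sub_distrib]
    exact Finset.sum_congr rfl fun i _ ↦ by ring
  rw [this, cos_sub_int_mul_two_pi]

lemma volume_torusDist_le_inter_abs_add_cos_lt_le {b c : Fin 3 → ℤ}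
    (hbc : |∑ i, (b i : ℝ) * c i| ≤ √(∑ i, (b i : ℝ) ^ 2) * √(∑ i, (c i : ℝ) ^ 2) / √3)
    (hc : 0 < √(∑ i, (c i : ℝ) ^ 2)) {α β R : ℝ} (hα : 1 / 2 ≤ α) (hR : 0 < R)
    (hbR1 : 3 / 4 ≤ √(∑ i, (b i : ℝ) ^ 2) * R) (hbR2 : √(∑ i, (b i : ℝ) ^ 2) * R ≤ 2)
    (ystar : Fin 3 → ℝ) :
    volume {y : Fin 3 → ℝ | (∀ i, y i ∈ Set.Ico (-π) π) ∧ torusDist y ystar ≤ R ∧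
        |α * cos (∑ i, (b i : ℝ) * y i) + β * cos (∑ i, (c i : ℝ) * y i)| < 2 * hSmall} ≤
      ENNReal.ofReal (24 * π * R ^ 3 * √hSmall) := by
  set N := √(∑ i, (b i : ℝ) ^ 2)
  have hN : 0 < N := pos_of_mul_pos_left (by linarith) hR.le
  set T : Set (Fin 3 → ℝ) := {x | √(∑ i, (x i - ystar i) ^ 2) ≤ 1.1 * R ∧
    |α * cos (∑ i, (b i : ℝ) * x i) + β * cos (∑ i, (c i : ℝ) * x i)| < 2 * hSmall}
  have hT : MeasurableSet T := by
    have h1 : Continuous fun x : Fin 3 → ℝ ↦ √(∑ i, (x i - ystar i) ^ 2) := by fun_prop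
    have h2 : Continuous fun x : Fin 3 → ℝ ↦
      |α * cos (∑ i, (b i : ℝ) * x i) + β * cos (∑ i, (c i : ℝ) * x i)| := by fun_prop
    exact (isClosed_le h1 continuous_const).measurableSet.inter
      (isOpen_lt h2 continuous_const).measurableSet
  refine (volume_le_of_translate_mem hT ?_).trans ?_
  · rintro y ⟨hy1, hy2, hy3⟩
    refine ⟨hy1, ?_⟩
    obtain ⟨m, hm⟩ := exists_lt_of_ciInf_lt (hy2.trans_lt (show R < 1.1 * R by linarith))
    refine ⟨m, ?_, ?_⟩
    · simp_rw [sub_right_comm _ (ystar _)] at hm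
      exact hm.le
    · simp only [cos_sum_mul_sub_two_pi]
      exact hy3
  have hmp := (PiLp.volume_preserving_toLp (Fin 3)).comp
    (measurePreserving_sub_right (volume : Measure (Fin 3 → ℝ)) ystar)
  have key := volume_closedBall_inter_abs_add_cos_lt_le (p := intVec b) (q := intVec c)
    (u := ∑ i, (b i : ℝ) * ystar i) (v := ∑ i, (c i : ℝ) * ystar i) (r := 1.1 * R)
    (η := 2 * hSmall) (α := α) (β := β)
    (by rw [← norm_pos_iff, norm_intVec]; exact hN)
    (by rw [← norm_pos_iff, norm_intVec]; exact hc)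
    (by rw [norm_intVec, norm_intVec, inner_intVec]; exact hbc)
    hα (by positivity)
    (by rw [norm_intVec]; nlinarith [pi_gt_three])
    (by linarith [hSmall_le])
  rw [norm_intVec] at key
  have hpre : T ⊆ (WithLp.toLp 2 ∘ fun x ↦ x - ystar) ⁻¹' {x : EuclideanSpace ℝ (Fin 3) |
      ‖x‖ ≤ 1.1 * R ∧ |α * cos (inner ℝ (intVec b) x + ∑ i, (b i : ℝ) * ystar i) +
        β * cos (inner ℝ (intVec c) x + ∑ i, (c i : ℝ) * ystar i)| < 2 * hSmall} := by
    rintro x ⟨hx1, hx2⟩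
    refine ⟨?_, ?_⟩
    · simpa [EuclideanSpace.norm_eq] using hx1
    · simpa only [Function.comp_apply, inner_intVec, Pi.sub_apply, ← Finset.sum_add_distrib,
        ← mul_add, sub_add_cancel] using hx2
  refine ((measure_mono hpre).trans (hmp.measure_preimage_le _)).trans (key.trans ?_)
  refine ENNReal.ofReal_le_ofReal ?_
  have hs : √(2 * (2 * hSmall)) = 2 * √hSmall := by
    rw [show 2 * (2 * hSmall) = 2 ^ 2 * hSmall by ring, sqrt_mul (by norm_num), sqrt_sq two_pos.le]
  rw [hs, div_le_iff₀ hN]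
  have h1 : 54 ≤ 24 * π * (N * R) := by nlinarith [pi_gt_three]
  have h2 : 0 ≤ R ^ 2 * √hSmall := by positivity
  nlinarith [mul_le_mul_of_nonneg_right h1 h2]

/-- **Lemma 2.5.** Let `k ≥ 2`, `w_k ≤ w ≤ w_{k+1}`, `1/(2√(k+2)) ≤ R ≤ 1/(2√(k-1))`,
`y* ∈ T³`. Then `mes₃{y ∈ T³ : dist(y,y*) ≤ R, (w,y) ∈ Ω} ≤ 24πR³√h`
(the measure on `T³` computed on the fundamental domain `[-π,π)³`). -/
theorem statement10 (ζ : ℝ → ℝ) (hζ : IsCutoff ζ) (a : ℕ → Fin 3 → ℤ) (ha : IsGoodSeq a)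
    (k : ℕ) (hk : 2 ≤ k) (w : ℝ) (hw1 : wseq k ≤ w) (hw2 : w ≤ wseq (k + 1))
    (R : ℝ) (hR1 : 1 / (2 * Real.sqrt ((k : ℝ) + 2)) ≤ R)
    (hR2 : R ≤ 1 / (2 * Real.sqrt ((k : ℝ) - 1)))
    (ystar : Fin 3 → ℝ) :
    volume {y : Fin 3 → ℝ | (∀ i, y i ∈ Set.Ico (-π) π) ∧
        torusDist y ystar ≤ R ∧ (w, y) ∈ OmegaSet ζ a} ≤
      ENNReal.ofReal (24 * π * R ^ 3 * Real.sqrt hSmall) := by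
  have hk' : (2 : ℝ) ≤ k := by exact_mod_cast hk
  have hR : 0 < R := lt_of_lt_of_le (by positivity) hR1
  have hnorm : ∀ j : ℕ, 1 ≤ j → ∑ i, (a j i : ℝ) ^ 2 = 4 * j + 1 := fun j hj ↦ by
    exact_mod_cast (ha j hj).1
  have hRge : ∀ N : ℝ, 4 * (k : ℝ) + 1 ≤ N → 3 / 4 ≤ √N * R := fun N hN ↦ by
    have h1 : √((k : ℝ) + 2) * (3 / 2) ≤ √N := by
      refine le_sqrt_of_sq_le ?_
      rw [mul_pow, sq_sqrt (by linarith)]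
      linarith
    calc 3 / 4 = √((k : ℝ) + 2) * (3 / 2) * (1 / (2 * √((k : ℝ) + 2))) := by
          have : √((k : ℝ) + 2) ≠ 0 := (sqrt_pos.2 (by linarith)).ne'
          field_simp
          norm_num
      _ ≤ √N * R := by gcongr
  have hRle : ∀ N : ℝ, N ≤ 4 * (k : ℝ) + 5 → √N * R ≤ 2 := fun N hN ↦ by
    have h1 : √N ≤ √((k : ℝ) - 1) * 4 := by
      refine sqrt_le_iff.2 ⟨by positivity, ?_⟩
      rw [mul_pow, sq_sqrt (by linarith)]
      linarith
    calc √N * R ≤ √((k : ℝ) - 1) * 4 * (1 / (2 * √((k : ℝ) - 1))) := by gcongr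
      _ = 2 := by
          have : √((k : ℝ) - 1) ≠ 0 := (sqrt_pos.2 (by linarith)).ne'
          field_simp
          norm_num
  have hk1 := hnorm k (by omega)
  have hk2 := hnorm (k + 1) (by omega)
  push_cast at hk2
  have hdot := (ha k (by omega)).2
  obtain ⟨z, hz⟩ := exists_f0_eq hζ a hk hw1 hw2
  rcases le_total z (1 / 2) with h | h
  · refine (measure_mono ?_).trans (volume_torusDist_le_inter_abs_add_cos_lt_le (α := 1 - z)
      (β := z) hdot (by rw [hk2]; positivity) (by linarith) hR (by rw [hk1]; exact hRge _ le_rfl)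
      (by rw [hk1]; exact hRle _ (by linarith)) ystar)
    rintro y ⟨hy1, hy2, -, hy3⟩
    exact ⟨hy1, hy2, by rwa [← hz]⟩
  · refine (measure_mono ?_).trans (volume_torusDist_le_inter_abs_add_cos_lt_le (b := a (k + 1))
      (c := a k) (α := z) (β := 1 - z) ?_ (by rw [hk1]; positivity) h hR
      (by rw [hk2]; exact hRge _ (by linarith)) (by rw [hk2]; exact hRle _ (by linarith)) ystar)
    · rintro y ⟨hy1, hy2, -, hy3⟩
      exact ⟨hy1, hy2, by rwa [add_comm, ← hz]⟩
    · simp_rw [mul_comm (a (k + 1) _ : ℝ)]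
      rwa [mul_comm (√_)]

end
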